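/- Let M₂ be the 9×9 symmetric integer matrix with diagonal entries (−3,−3,−4,−5,−3,−2,−3,−3,−2), with all entries immediately above and below the diagonal equal to 1, and all other entries 0. Then M₂ (viewed as a real matrix) is negative definite, and det M₂ = −6241 = −79². -/

import Mathlib

open Matrix

/-- The intersection matrix of the second Wahl chain `𝒞₂`: 9×9 symmetric tridiagonal with
diagonal `(−3,−3,−4,−5,−3,−2,−3,−3,−2)` and off-diagonal entries `1`. -/
def M₂ : Matrix (Fin 9) (Fin 9) ℤ := fun i j =>
  if i = j then ![-3, -3, -4, -5, -3, -2, -3, -3, -2] i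
  else if (i : ℕ) + 1 = (j : ℕ) ∨ (j : ℕ) + 1 = (i : ℕ) then 1 else 0

theorem M₂_eq_of : M₂ =
    !![-3, 1, 0, 0, 0, 0, 0, 0, 0;
      1, -3, 1, 0, 0, 0, 0, 0, 0;
      0, 1, -4, 1, 0, 0, 0, 0, 0;
      0, 0, 1, -5, 1, 0, 0, 0, 0;
      0, 0, 0, 1, -3, 1, 0, 0, 0;
      0, 0, 0, 0, 1, -2, 1, 0, 0;
      0, 0, 0, 0, 0, 1, -3, 1, 0;
      0, 0, 0, 0, 0, 0, 1, -3, 1;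
      0, 0, 0, 0, 0, 0, 0, 1, -2] := by
  decide

theorem M₂_quadForm_eq (v : Fin 9 → ℝ) :
    v ⬝ᵥ (M₂.map (Int.cast : ℤ → ℝ)).mulVec v =
      -(∑ i : Fin 8, (v i.castSucc - v i.succ) ^ 2 + 2 * v 0 ^ 2 + v 1 ^ 2 + 2 * v 2 ^ 2 +
        3 * v 3 ^ 2 + v 4 ^ 2 + v 6 ^ 2 + v 7 ^ 2 + v 8 ^ 2) := by
  rw [M₂_eq_of]
  simp [dotProduct, mulVec, Fin.sum_univ_succ]
  ring

/-- The leading principal minors of `M₂`, starting with the empty one. -/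
def leadingMinor : Fin 10 → ℤ := ![1, -3, 8, -29, 137, -382, 627, -1499, 3870, -6241]

/-- The unit lower bidiagonal factor in the fraction-free factorization of `M₂`. -/
def lowerFactor : Matrix (Fin 9) (Fin 9) ℤ := of fun i j =>
  if i = j ∨ (j : ℕ) + 1 = (i : ℕ) then 1 else 0

/-- The upper bidiagonal factor in the fraction-free factorization of `M₂`. -/
def upperFactor : Matrix (Fin 9) (Fin 9) ℤ := of fun i j =>
  if i = j then leadingMinor i.succ
  else if (i : ℕ) + 1 = (j : ℕ) then leadingMinor i.castSucc else 0

theorem diagonal_mul_M₂ :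
    diagonal (fun i : Fin 9 => leadingMinor i.castSucc) * M₂ = lowerFactor * upperFactor := by
  decide +kernel

theorem lowerFactor_det : lowerFactor.det = 1 := by
  rw [det_of_isLowerTriangular]
  · simp [lowerFactor]
  · intro i j hij
    have : i < j := hij
    simp only [lowerFactor, of_apply]
    grind

theorem upperFactor_det : upperFactor.det = ∏ i : Fin 9, leadingMinor i.succ := by
  rw [det_of_isUpperTriangular]
  · simp [upperFactor]
  · intro i j hij
    have : j < i := hij
    simp only [upperFactor, of_apply]
    grind

theorem M₂_det : M₂.det = -6241 := by
  have h := congrArg det diagonal_mul_M₂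
  rw [det_mul, det_mul, det_diagonal, lowerFactor_det, upperFactor_det, one_mul] at h
  simp [leadingMinor, Fin.prod_univ_succ] at h
  lia

/-- The matrix `M₂`, viewed as a real matrix, is negative definite
(the associated quadratic form is strictly negative on all nonzero vectors), and
`det M₂ = −6241 = −79²`. -/
theorem M₂_negDef_and_det :
    (∀ v : Fin 9 → ℝ, v ≠ 0 → v ⬝ᵥ (M₂.map (Int.cast : ℤ → ℝ)).mulVec v < 0) ∧
      M₂.det = -6241 ∧ (-6241 : ℤ) = -79 ^ 2 := by
  refine ⟨fun v hv => ?_, M₂_det, by norm_num⟩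
  rw [M₂_quadForm_eq, neg_lt_zero]
  by_contra! hle
  have hsum : 0 ≤ ∑ i : Fin 8, (v i.castSucc - v i.succ) ^ 2 := by positivity
  have h0 : v 0 = 0 := by
    rw [← sq_eq_zero_iff]
    linarith [sq_nonneg (v 0), sq_nonneg (v 1), sq_nonneg (v 2), sq_nonneg (v 3), sq_nonneg (v 4),
      sq_nonneg (v 6), sq_nonneg (v 7), sq_nonneg (v 8)]
  have hsum0 : ∑ i : Fin 8, (v i.castSucc - v i.succ) ^ 2 = 0 := by
    refine le_antisymm ?_ hsum
    linarith [sq_nonneg (v 0), sq_nonneg (v 1), sq_nonneg (v 2), sq_nonneg (v 3), sq_nonneg (v 4),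
      sq_nonneg (v 6), sq_nonneg (v 7), sq_nonneg (v 8)]
  have hstep (i : Fin 8) : v i.castSucc = v i.succ := by
    have := (Finset.sum_eq_zero_iff_of_nonneg fun i _ => sq_nonneg _).mp hsum0 i (Finset.mem_univ i)
    exact sub_eq_zero.mp (sq_eq_zero_iff.mp this)
  refine hv (funext fun i => ?_)
  induction i using Fin.induction with
  | zero => exact h0
  | succ i ih => exact (hstep i).symm.trans ih
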